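/- Let E, B, P, J be twice continuously differentiable ℝ³-valued fields and N_e a continuously differentiable real-valued field on ℝ³×[0,T] satisfying the Ampère–Maxwell law ∂ₜE = c∇×B − 4π∂ₜP − 4πJ and the Drude equation ∂ₜJ = −ν_e J + N_e E, with E, P, J satisfying the Dirichlet support condition, and let η > 0. Set M := sup_{Ω×[0,T]} N_e² and M₁ := sup_{Ω×[0,T]} |∇N_e|². Then ‖∇·E(·,T)‖²_{L²(Ω)} + η²‖∇·J(·,T)‖²_{L²(Ω)} ≤ ‖∇·E(·,0)‖²_{L²(Ω)} + η²‖∇·J(·,0)‖²_{L²(Ω)} + (8π/η + η³M)∫₀ᵀ‖∇·E(·,t)‖²_{L²(Ω)} dt + (4πη + 2ν_eη² + 2η)∫₀ᵀ‖∇·J(·,t)‖²_{L²(Ω)} dt + η³M₁∫₀ᵀ‖E(·,t)‖²_{L²(Ω)} dt + 4πη∫₀ᵀ‖∂ₜ(∇·P)(·,t)‖²_{L²(Ω)} dt. -/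

import Mathlib

open MeasureTheory
open scoped RealInnerProductSpace

noncomputable section

/-- `V3` is Euclidean three-dimensional space. -/
abbrev V3 : Type := EuclideanSpace ℝ (Fin 3)

/-- spatial partial derivative in direction `i` of a scalar field -/
def pd (i : Fin 3) (g : V3 → ℝ) (x : V3) : ℝ :=
  fderiv ℝ g x (EuclideanSpace.single i 1)

/-- spatial divergence of a vector field -/
def sdiv (F : V3 → V3) (x : V3) : ℝ := ∑ i, pd i (fun y => F y i) x

/-- build a vector in `V3` from three coordinates -/
def vec3 (a b c : ℝ) : V3 := (WithLp.equiv 2 (Fin 3 → ℝ)).symm ![a, b, c]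

/-- spatial curl of a vector field -/
def scurl (F : V3 → V3) (x : V3) : V3 :=
  vec3 (pd 1 (fun y => F y 2) x - pd 2 (fun y => F y 1) x)
       (pd 2 (fun y => F y 0) x - pd 0 (fun y => F y 2) x)
       (pd 0 (fun y => F y 1) x - pd 1 (fun y => F y 0) x)

/-- spatial gradient of a scalar field -/
def sgrad (g : V3 → ℝ) (x : V3) : V3 :=
  (WithLp.equiv 2 (Fin 3 → ℝ)).symm (fun i => pd i g x)

/-- spatial Laplacian of a scalar field -/
def slap (g : V3 → ℝ) (x : V3) : ℝ := ∑ i, pd i (fun y => pd i g y) x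

/-- componentwise spatial Laplacian of a vector field -/
def veclap (F : V3 → V3) (x : V3) : V3 :=
  (WithLp.equiv 2 (Fin 3 → ℝ)).symm (fun i => slap (fun y => F y i) x)

/-- cross product on `V3` -/
def cross3 (a b : V3) : V3 :=
  vec3 (a 1 * b 2 - a 2 * b 1) (a 2 * b 0 - a 0 * b 2) (a 0 * b 1 - a 1 * b 0)

/-- The Dirichlet support condition: for every `t ∈ [0,T]` the spatial support of the
field is contained in a fixed compact subset of `Ω` (encoding zero Dirichlet BCs). -/
def DirichletBC {α : Type} [Zero α] (Ω : Set V3) (T : ℝ) (F : V3 → ℝ → α) : Prop :=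
  ∃ K : Set V3, IsCompact K ∧ K ⊆ Ω ∧
    ∀ t ∈ Set.Icc (0:ℝ) T, (Function.support fun x => F x t) ⊆ K

section DirectionalDerivatives

variable {X : Type*} [NormedAddCommGroup X] [NormedSpace ℝ X]

lemma contDiff_fderiv_apply_const {n m : ℕ} (h : n + 1 ≤ m) {g : X → ℝ} (hg : ContDiff ℝ m g)
    (v : X) : ContDiff ℝ n (fun p => fderiv ℝ g p v) :=
  (hg.fderiv_right (by exact_mod_cast h)).clm_apply contDiff_const

lemma fderiv_fderiv_apply_comm {g : X → ℝ} (hg : ContDiff ℝ 2 g) (v w x : X) :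
    fderiv ℝ (fun p => fderiv ℝ g p v) x w = fderiv ℝ (fun p => fderiv ℝ g p w) x v := by
  have hd : DifferentiableAt ℝ (fderiv ℝ g) x :=
    ((hg.fderiv_right (m := 1) (by norm_num)).differentiable (by norm_num)) x
  have hs : IsSymmSndFDerivAt ℝ g x := hg.contDiffAt.isSymmSndFDerivAt (by simp)
  rw [fderiv_clm_apply hd (differentiableAt_const v),
    fderiv_clm_apply hd (differentiableAt_const w)]
  simpa using hs.eq w v

end DirectionalDerivatives

section Slices

lemma pd_slice {g : V3 × ℝ → ℝ} (hg : Differentiable ℝ g) (i : Fin 3) (x : V3) (t : ℝ) :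
    pd i (fun y => g (y, t)) x = fderiv ℝ g (x, t) (EuclideanSpace.single i 1, 0) := by
  have h : HasFDerivAt (fun y : V3 => (y, t)) (ContinuousLinearMap.inl ℝ V3 ℝ) x :=
    hasFDerivAt_prodMk_left x t
  have h2 := (hg (x, t)).hasFDerivAt.comp x h
  have h3 : fderiv ℝ (fun y => g (y, t)) x = _ := h2.fderiv
  simp [pd, h3]

lemma hasDerivAt_slice {g : V3 × ℝ → ℝ} (hg : Differentiable ℝ g) (x : V3) (t : ℝ) :
    HasDerivAt (fun s => g (x, s)) (fderiv ℝ g (x, t) (0, 1)) t := by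
  have h2 := (hg (x, t)).hasFDerivAt.comp t (hasFDerivAt_prodMk_right x t)
  have h3 : HasDerivAt (fun s => g (x, s)) _ t := h2.hasDerivAt
  simpa using h3

lemma deriv_pd_comm {g : V3 × ℝ → ℝ} (hg : ContDiff ℝ 2 g) (i : Fin 3) (x : V3) (t : ℝ) :
    HasDerivAt (fun s => pd i (fun y => g (y, s)) x)
      (pd i (fun y => deriv (fun s => g (y, s)) t) x) t := by
  have hd : Differentiable ℝ g := hg.differentiable (by norm_num)
  have hv (v : V3 × ℝ) : Differentiable ℝ (fun p => fderiv ℝ g p v) :=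
    (contDiff_fderiv_apply_const (n := 1) (m := 2) le_rfl hg v).differentiable (by norm_num)
  simp_rw [pd_slice hd, fun y => (hasDerivAt_slice hd y t).deriv]
  rw [pd_slice (hv (0, 1)), fderiv_fderiv_apply_comm hg]
  exact hasDerivAt_slice (hv _) x t

lemma pd_comm {g : V3 → ℝ} (hg : ContDiff ℝ 2 g) (i j : Fin 3) (x : V3) :
    pd i (fun y => pd j g y) x = pd j (fun y => pd i g y) x :=
  fderiv_fderiv_apply_comm hg _ _ x

lemma differentiable_pd {g : V3 → ℝ} (hg : ContDiff ℝ 2 g) (i : Fin 3) :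
    Differentiable ℝ (fun y => pd i g y) :=
  (contDiff_fderiv_apply_const (n := 1) (m := 2) le_rfl hg _).differentiable (by norm_num)

lemma contDiff_coord {n : WithTop ℕ∞} {X : Type*} [NormedAddCommGroup X] [NormedSpace ℝ X]
    {F : X → V3} (hF : ContDiff ℝ n F) (i : Fin 3) : ContDiff ℝ n (fun p => F p i) :=
  contDiff_euclidean.1 hF i

lemma pd_sub {f g : V3 → ℝ} {x : V3} (hf : DifferentiableAt ℝ f x)
    (hg : DifferentiableAt ℝ g x) (i : Fin 3) :
    pd i (fun y => f y - g y) x = pd i f x - pd i g x := by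
  simp [pd, fderiv_fun_sub hf hg]

lemma pd_add {f g : V3 → ℝ} {x : V3} (hf : DifferentiableAt ℝ f x)
    (hg : DifferentiableAt ℝ g x) (i : Fin 3) :
    pd i (fun y => f y + g y) x = pd i f x + pd i g x := by
  simp [pd, fderiv_fun_add hf hg]

lemma pd_const_mul {f : V3 → ℝ} {x : V3} (hf : DifferentiableAt ℝ f x) (a : ℝ) (i : Fin 3) :
    pd i (fun y => a * f y) x = a * pd i f x := by
  simp [pd, fderiv_const_mul hf]

lemma pd_mul {f g : V3 → ℝ} {x : V3} (hf : DifferentiableAt ℝ f x)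
    (hg : DifferentiableAt ℝ g x) (i : Fin 3) :
    pd i (fun y => f y * g y) x = f x * pd i g x + g x * pd i f x := by
  simp [pd, fderiv_fun_mul hf hg]

lemma sdiv_add {F G : V3 → V3} {x : V3} (hF : DifferentiableAt ℝ F x)
    (hG : DifferentiableAt ℝ G x) : sdiv (fun y => F y + G y) x = sdiv F x + sdiv G x := by
  simp only [sdiv, PiLp.add_apply, ← Finset.sum_add_distrib]
  exact Finset.sum_congr rfl fun i _ =>
    pd_add (differentiableAt_euclidean.1 hF i) (differentiableAt_euclidean.1 hG i) i

lemma sdiv_const_smul {F : V3 → V3} {x : V3} (hF : DifferentiableAt ℝ F x) (a : ℝ) :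
    sdiv (fun y => a • F y) x = a * sdiv F x := by
  simp only [sdiv, PiLp.smul_apply, smul_eq_mul, Finset.mul_sum]
  exact Finset.sum_congr rfl fun i _ => pd_const_mul (differentiableAt_euclidean.1 hF i) a i

lemma sdiv_fun_smul {f : V3 → ℝ} {F : V3 → V3} {x : V3} (hf : DifferentiableAt ℝ f x)
    (hF : DifferentiableAt ℝ F x) :
    sdiv (fun y => f y • F y) x = f x * sdiv F x + ⟪F x, sgrad f x⟫ := by
  have (i : Fin 3) := pd_mul hf (differentiableAt_euclidean.1 hF i) i
  simp only [sdiv, PiLp.smul_apply, smul_eq_mul, this, Finset.sum_add_distrib, Finset.mul_sum]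
  simp [sgrad, PiLp.inner_apply, mul_comm]

lemma differentiable_scurl {F : V3 → V3} (hF : ContDiff ℝ 2 F) :
    Differentiable ℝ (scurl F) := by
  have h (i j : Fin 3) := differentiable_pd (contDiff_coord hF j) i
  refine differentiable_euclidean.2 fun i => ?_
  fin_cases i
  · exact (h 1 2).sub (h 2 1)
  · exact (h 2 0).sub (h 0 2)
  · exact (h 0 1).sub (h 1 0)

lemma sdiv_scurl {F : V3 → V3} (hF : ContDiff ℝ 2 F) (x : V3) : sdiv (scurl F) x = 0 := by
  have h (i j : Fin 3) := differentiable_pd (contDiff_coord hF j) i x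
  have h0 : pd 0 (fun y => scurl F y 0) x = _ := pd_sub (h 1 2) (h 2 1) 0
  have h1 : pd 1 (fun y => scurl F y 1) x = _ := pd_sub (h 2 0) (h 0 2) 1
  have h2 : pd 2 (fun y => scurl F y 2) x = _ := pd_sub (h 0 1) (h 1 0) 2
  rw [sdiv, Fin.sum_univ_three, h0, h1, h2, pd_comm (contDiff_coord hF 2) 1 0,
    pd_comm (contDiff_coord hF 1) 2 0, pd_comm (contDiff_coord hF 0) 2 1]
  ring

variable {F : V3 → ℝ → V3}

lemma contDiff_space_slice (hF : ContDiff ℝ 2 (fun p : V3 × ℝ => F p.1 p.2)) (t : ℝ) :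
    ContDiff ℝ 2 (fun y => F y t) :=
  hF.comp (contDiff_id.prodMk contDiff_const)

lemma differentiable_time_slice (hF : ContDiff ℝ 2 (fun p : V3 × ℝ => F p.1 p.2)) (x : V3) :
    Differentiable ℝ (F x) :=
  (hF.comp (contDiff_const.prodMk contDiff_id)).differentiable (by norm_num)

lemma deriv_coord (hF : ContDiff ℝ 2 (fun p : V3 × ℝ => F p.1 p.2)) (i : Fin 3) (x : V3)
    (t : ℝ) : deriv (F x) t i = deriv (fun s => F x s i) t :=
  ((EuclideanSpace.proj (𝕜 := ℝ) i).hasFDerivAt.comp_hasDerivAt t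
    (differentiable_time_slice hF x t).hasDerivAt).deriv.symm

lemma differentiable_deriv_slice (hF : ContDiff ℝ 2 (fun p : V3 × ℝ => F p.1 p.2)) (t : ℝ) :
    Differentiable ℝ (fun y => deriv (F y) t) := by
  refine differentiable_euclidean.2 fun i => ?_
  have hi := contDiff_coord hF i
  simp_rw [deriv_coord hF,
    fun y => (hasDerivAt_slice (hi.differentiable (by norm_num)) y t).deriv]
  exact ((contDiff_fderiv_apply_const (n := 1) (m := 2) le_rfl hi _).differentiable
    (by norm_num)).comp (differentiable_id.prodMk (differentiable_const t))

lemma hasDerivAt_sdiv (hF : ContDiff ℝ 2 (fun p : V3 × ℝ => F p.1 p.2)) (x : V3) (t : ℝ) :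
    HasDerivAt (fun s => sdiv (fun y => F y s) x) (sdiv (fun y => deriv (F y) t) x) t := by
  simp only [sdiv, deriv_coord hF]
  exact HasDerivAt.fun_sum fun i _ => deriv_pd_comm (contDiff_coord hF i) i x t

lemma contDiff_sdiv (hF : ContDiff ℝ 2 (fun p : V3 × ℝ => F p.1 p.2)) :
    ContDiff ℝ 1 (fun p : V3 × ℝ => sdiv (fun y => F y p.2) p.1) := by
  have h (i : Fin 3) (p : V3 × ℝ) :=
    pd_slice ((contDiff_coord hF i).differentiable (by norm_num)) i p.1 p.2
  simp only [sdiv, h]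
  exact ContDiff.sum fun i _ =>
    contDiff_fderiv_apply_const (n := 1) (m := 2) le_rfl (contDiff_coord hF i) _

lemma continuous_deriv_sdiv (hF : ContDiff ℝ 2 (fun p : V3 × ℝ => F p.1 p.2)) :
    Continuous (fun p : V3 × ℝ => deriv (fun s => sdiv (fun y => F y s) p.1) p.2) := by
  have h (p : V3 × ℝ) :=
    (hasDerivAt_slice ((contDiff_sdiv hF).differentiable (by norm_num)) p.1 p.2).deriv
  simp only [h]
  exact (contDiff_fderiv_apply_const (n := 0) (m := 1) le_rfl (contDiff_sdiv hF) _).continuous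

end Slices

section Integration

variable {Ω : Set V3} {f : V3 × ℝ → ℝ}

lemma integrableOn_of_isBounded {g : V3 → ℝ} (hΩb : Bornology.IsBounded Ω)
    (hg : Continuous g) : IntegrableOn g Ω :=
  (hg.continuousOn.integrableOn_compact hΩb.isCompact_closure).mono_set subset_closure

lemma integrable_prod_of_isBounded (hΩb : Bornology.IsBounded Ω) (hf : Continuous f) (T : ℝ) :
    Integrable f ((volume.restrict Ω).prod (volume.restrict (Set.Ioc 0 T))) := by
  rw [Measure.prod_restrict]
  exact (hf.continuousOn.integrableOn_compact
    (hΩb.isCompact_closure.prod isCompact_Icc)).mono_set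
    (Set.prod_mono subset_closure Set.Ioc_subset_Icc_self)

lemma intervalIntegrable_setIntegral (hΩb : Bornology.IsBounded Ω) (hf : Continuous f) {T : ℝ}
    (hT : 0 ≤ T) : IntervalIntegrable (fun t => ∫ x in Ω, f (x, t)) volume 0 T :=
  (intervalIntegrable_iff_integrableOn_Ioc_of_le hT).2
    (integrable_prod_of_isBounded hΩb hf T).integral_prod_right

/-- If the time derivative of `e` is bounded by `f` on a bounded measurable set, then the
integral of `e` over that set grows at most by the space-time integral of `f`. -/
lemma setIntegral_le_add_of_deriv_le (hΩm : MeasurableSet Ω) (hΩb : Bornology.IsBounded Ω)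
    {T : ℝ} (hT : 0 ≤ T) {e : V3 × ℝ → ℝ} (he : ContDiff ℝ 1 e) (hf : Continuous f)
    (hle : ∀ x ∈ Ω, ∀ t ∈ Set.Icc 0 T, deriv (fun s => e (x, s)) t ≤ f (x, t)) :
    ∫ x in Ω, e (x, T) ≤ (∫ x in Ω, e (x, 0)) + ∫ t in (0 : ℝ)..T, ∫ x in Ω, f (x, t) := by
  have hslice (t : ℝ) : IntegrableOn (fun x => e (x, t)) Ω :=
    integrableOn_of_isBounded hΩb (he.continuous.comp (by fun_prop))
  have hprod := integrable_prod_of_isBounded hΩb hf T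
  have hswap : ∫ t in (0 : ℝ)..T, ∫ x in Ω, f (x, t)
      = ∫ x in Ω, ∫ t in Set.Ioc 0 T, f (x, t) := by
    rw [intervalIntegral.integral_of_le hT]
    exact (integral_integral_swap (f := fun x t => f (x, t)) hprod).symm
  rw [hswap, ← integral_add (hslice 0) hprod.integral_prod_left]
  refine setIntegral_mono_on (hslice T) ((hslice 0).add hprod.integral_prod_left) hΩm
    fun x hx => ?_
  have hex : ContDiff ℝ 1 (fun s => e (x, s)) :=
    he.comp (contDiff_const.prodMk contDiff_id)
  have hder : Continuous (deriv fun s => e (x, s)) := hex.continuous_deriv (by norm_num)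
  have hftc : ∫ t in (0 : ℝ)..T, deriv (fun s => e (x, s)) t = e (x, T) - e (x, 0) :=
    intervalIntegral.integral_deriv_eq_sub
      (fun t _ => hex.differentiable (by norm_num) t) (hder.intervalIntegrable _ _)
  have hfx : Continuous fun t => f (x, t) := by fun_prop
  have hmono := intervalIntegral.integral_mono_on hT (hder.intervalIntegrable 0 T)
    (hfx.intervalIntegrable (μ := volume) 0 T) (hle x hx)
  rw [hftc, intervalIntegral.integral_of_le hT] at hmono
  linarith

lemma integral_combination (hΩb : Bornology.IsBounded Ω) {T : ℝ} (hT : 0 ≤ T)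
    {ι : Type*} (s : Finset ι) (k : ι → ℝ) {g : ι → V3 × ℝ → ℝ} (hg : ∀ i, Continuous (g i)) :
    ∫ t in (0 : ℝ)..T, ∫ x in Ω, ∑ i ∈ s, k i * g i (x, t)
      = ∑ i ∈ s, k i * ∫ t in (0 : ℝ)..T, ∫ x in Ω, g i (x, t) := by
  have hx (t : ℝ) : ∫ x in Ω, ∑ i ∈ s, k i * g i (x, t)
      = ∑ i ∈ s, k i * ∫ x in Ω, g i (x, t) := by
    rw [integral_finsetSum]
    · simp_rw [integral_const_mul]
    · exact fun i _ => (integrableOn_of_isBounded hΩb ((hg i).comp (by fun_prop))).const_mul _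
  simp_rw [hx]
  rw [intervalIntegral.integral_finsetSum]
  · simp_rw [intervalIntegral.integral_const_mul]
  · exact fun i _ => (intervalIntegrable_setIntegral hΩb (hg i) hT).const_mul _

end Integration

/-- Weighted Young inequalities bounding the production of the energy `u² + η² v²`. -/
lemma energy_production_le {u v w n r M M₁ g e η ν : ℝ} (hη : 0 < η) (hν : 0 ≤ ν)
    (hn : n ^ 2 ≤ M) (hg : g ^ 2 ≤ M₁) (hr : |r| ≤ e * g) :
    2 * u * (-(4 * Real.pi) * w - 4 * Real.pi * v) + η ^ 2 * (2 * v * (-ν * v + (n * u + r)))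
      ≤ (8 * Real.pi / η + η ^ 3 * M) * u ^ 2 + (4 * Real.pi * η + 2 * ν * η ^ 2 + 2 * η) * v ^ 2
        + η ^ 3 * M₁ * e ^ 2 + 4 * Real.pi * η * w ^ 2 := by
  have young (z : ℝ) : -(8 * Real.pi * (u * z)) ≤ 4 * Real.pi / η * u ^ 2
      + 4 * Real.pi * η * z ^ 2 := by
    have : 4 * Real.pi / η * u ^ 2 + 4 * Real.pi * η * z ^ 2 + 8 * Real.pi * (u * z)
        = 4 * Real.pi / η * (u + η * z) ^ 2 := by field_simp; ring
    have : 0 ≤ 4 * Real.pi / η * (u + η * z) ^ 2 := by positivity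
    linarith
  have hnu : 2 * η ^ 2 * v * (n * u) ≤ η * v ^ 2 + η ^ 3 * M * u ^ 2 := by
    have h1 : 0 ≤ η * (v - η * (n * u)) ^ 2 := by positivity
    have h2 : η ^ 3 * u ^ 2 * n ^ 2 ≤ η ^ 3 * u ^ 2 * M := by gcongr
    nlinarith
  have hr2 : r ^ 2 ≤ M₁ * e ^ 2 := by
    calc r ^ 2 = |r| ^ 2 := (sq_abs r).symm
      _ ≤ (e * g) ^ 2 := by gcongr
      _ = g ^ 2 * e ^ 2 := by ring
      _ ≤ M₁ * e ^ 2 := by gcongr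
  have hvr : 2 * η ^ 2 * v * r ≤ η * v ^ 2 + η ^ 3 * M₁ * e ^ 2 := by
    have h1 : 0 ≤ η * (v - η * r) ^ 2 := by positivity
    have h2 : η ^ 3 * r ^ 2 ≤ η ^ 3 * (M₁ * e ^ 2) := by gcongr
    nlinarith
  have hd : 0 ≤ ν * η ^ 2 * v ^ 2 := by positivity
  have hw := young w
  have hv := young v
  have hsplit : 8 * Real.pi / η = 4 * Real.pi / η + 4 * Real.pi / η := by ring
  rw [hsplit]
  linarith

theorem divE_divJ_energy_estimate (Ω : Set V3) (hΩo : IsOpen Ω) (hΩb : Bornology.IsBounded Ω)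
    (T : ℝ) (hT : 0 < T)
    (c : ℝ) (hc : 0 < c) (νe : ℝ) (hνe : 0 ≤ νe)
    (E B P J : V3 → ℝ → V3) (Ne : V3 → ℝ → ℝ)
    (hE : ContDiff ℝ 2 (fun p : V3 × ℝ => E p.1 p.2)) (hB : ContDiff ℝ 2 (fun p : V3 × ℝ => B p.1 p.2))
    (hP : ContDiff ℝ 2 (fun p : V3 × ℝ => P p.1 p.2)) (hJ : ContDiff ℝ 2 (fun p : V3 × ℝ => J p.1 p.2))
    (hNe : ContDiff ℝ 1 (fun p : V3 × ℝ => Ne p.1 p.2))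
    (hAmp : ∀ x : V3, ∀ t ∈ Set.Icc (0:ℝ) T,
      deriv (E x) t = c • scurl (fun y => B y t) x
        - (4*Real.pi) • deriv (P x) t - (4*Real.pi) • J x t)
    (hDrude : ∀ x : V3, ∀ t ∈ Set.Icc (0:ℝ) T,
      deriv (J x) t = -(νe • J x t) + Ne x t • E x t)
    (hEbc : DirichletBC Ω T E) (hPbc : DirichletBC Ω T P) (hJbc : DirichletBC Ω T J)
    (η : ℝ) (hη : 0 < η) (M M₁ : ℝ)
    (hM : IsLUB {r : ℝ | ∃ x ∈ Ω, ∃ t ∈ Set.Icc (0:ℝ) T, r = (Ne x t)^2} M)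
    (hM₁ : IsLUB {r : ℝ | ∃ x ∈ Ω, ∃ t ∈ Set.Icc (0:ℝ) T,
        r = ‖sgrad (fun y => Ne y t) x‖^2} M₁) :
    (∫ x in Ω, (sdiv (fun y => E y T) x)^2) + η^2 * (∫ x in Ω, (sdiv (fun y => J y T) x)^2)
      ≤ (∫ x in Ω, (sdiv (fun y => E y 0) x)^2) + η^2 * (∫ x in Ω, (sdiv (fun y => J y 0) x)^2)
        + (8*Real.pi/η + η^3*M) * (∫ t in (0:ℝ)..T, ∫ x in Ω, (sdiv (fun y => E y t) x)^2)
        + (4*Real.pi*η + 2*νe*η^2 + 2*η) * (∫ t in (0:ℝ)..T, ∫ x in Ω, (sdiv (fun y => J y t) x)^2)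
        + η^3*M₁ * (∫ t in (0:ℝ)..T, ∫ x in Ω, ‖E x t‖^2)
        + 4*Real.pi*η * (∫ t in (0:ℝ)..T, ∫ x in Ω,
            (deriv (fun s => sdiv (fun y => P y s) x) t)^2) := by
  set u : V3 × ℝ → ℝ := fun p => sdiv (fun y => E y p.2) p.1
  set v : V3 × ℝ → ℝ := fun p => sdiv (fun y => J y p.2) p.1
  set w : V3 × ℝ → ℝ := fun p => deriv (fun s => sdiv (fun y => P y s) p.1) p.2
  have hu1 : ContDiff ℝ 1 u := contDiff_sdiv hE
  have hv1 : ContDiff ℝ 1 v := contDiff_sdiv hJ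
  have hwc : Continuous w := continuous_deriv_sdiv hP
  have hEs (t : ℝ) : Differentiable ℝ (fun y => E y t) :=
    (contDiff_space_slice hE t).differentiable (by norm_num)
  have hJs (t : ℝ) : Differentiable ℝ (fun y => J y t) :=
    (contDiff_space_slice hJ t).differentiable (by norm_num)
  have hNs (t : ℝ) : Differentiable ℝ (fun y => Ne y t) :=
    (hNe.comp (contDiff_id.prodMk contDiff_const)).differentiable (by norm_num)
  have hut (x : V3) (t : ℝ) (ht : t ∈ Set.Icc 0 T) : HasDerivAt (fun s => u (x, s))
      (-(4 * Real.pi) * w (x, t) - 4 * Real.pi * v (x, t)) t := by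
    have hcurl := differentiable_scurl (contDiff_space_slice hB t) x
    have hPt := differentiable_deriv_slice hP t x
    have hrhs : sdiv (fun y => deriv (E y) t) x
        = -(4 * Real.pi) * w (x, t) - 4 * Real.pi * v (x, t) := by
      have hfun : (fun y => deriv (E y) t) = fun y => c • scurl (fun z => B z t) y
          + ((-(4 * Real.pi)) • deriv (P y) t + (-(4 * Real.pi)) • J y t) := by
        funext y
        rw [hAmp y t ht]
        module
      rw [hfun, sdiv_add (hcurl.fun_const_smul c)
          ((hPt.fun_const_smul _).fun_add ((hJs t x).fun_const_smul _)),
        sdiv_add (hPt.fun_const_smul _) ((hJs t x).fun_const_smul _), sdiv_const_smul hcurl,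
        sdiv_const_smul hPt, sdiv_const_smul (hJs t x),
        sdiv_scurl (contDiff_space_slice hB t), ← (hasDerivAt_sdiv hP x t).deriv]
      ring
    exact hrhs ▸ hasDerivAt_sdiv hE x t
  have hvt (x : V3) (t : ℝ) (ht : t ∈ Set.Icc 0 T) : HasDerivAt (fun s => v (x, s))
      (-νe * v (x, t) + (Ne x t * u (x, t) + ⟪E x t, sgrad (fun y => Ne y t) x⟫)) t := by
    have hrhs : sdiv (fun y => deriv (J y) t) x
        = -νe * v (x, t) + (Ne x t * u (x, t) + ⟪E x t, sgrad (fun y => Ne y t) x⟫) := by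
      have hfun : (fun y => deriv (J y) t) = fun y => (-νe) • J y t + Ne y t • E y t := by
        funext y
        rw [hDrude y t ht, neg_smul]
      rw [hfun, sdiv_add ((hJs t x).fun_const_smul _) ((hNs t x).fun_smul (hEs t x)),
        sdiv_const_smul (hJs t x), sdiv_fun_smul (hNs t x) (hEs t x)]
    exact hrhs ▸ hasDerivAt_sdiv hJ x t
  let k : Fin 4 → ℝ := ![8*Real.pi/η + η^3*M, 4*Real.pi*η + 2*νe*η^2 + 2*η, η^3*M₁, 4*Real.pi*η]
  let g : Fin 4 → V3 × ℝ → ℝ :=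
    ![fun p => u p ^ 2, fun p => v p ^ 2, fun p => ‖E p.1 p.2‖ ^ 2, fun p => w p ^ 2]
  have hg (i : Fin 4) : Continuous (g i) := by
    fin_cases i
    · exact hu1.continuous.pow 2
    · exact hv1.continuous.pow 2
    · exact hE.continuous.norm.pow 2
    · exact hwc.pow 2
  have hgrowth := setIntegral_le_add_of_deriv_le hΩo.measurableSet hΩb hT.le
    (e := fun p => u p ^ 2 + η ^ 2 * v p ^ 2) (f := fun p => ∑ i, k i * g i p)
    ((hu1.pow 2).add (contDiff_const.mul (hv1.pow 2)))
    (continuous_finsetSum _ fun i _ => continuous_const.mul (hg i)) (by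
      intro x hx t ht
      have hder := ((hut x t ht).fun_pow 2).fun_add (((hvt x t ht).fun_pow 2).const_mul (η ^ 2))
      rw [hder.deriv]
      have h := energy_production_le (u := u (x, t)) (v := v (x, t)) (w := w (x, t)) hη hνe
        (hM.1 ⟨x, hx, t, ht, rfl⟩) (hM₁.1 ⟨x, hx, t, ht, rfl⟩)
        (abs_real_inner_le_norm (E x t) (sgrad (fun y => Ne y t) x))
      simpa [Fin.sum_univ_four, k, g] using h)
  have hsplit (t : ℝ) : ∫ x in Ω, (u (x, t) ^ 2 + η ^ 2 * v (x, t) ^ 2)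
      = (∫ x in Ω, u (x, t) ^ 2) + η ^ 2 * ∫ x in Ω, v (x, t) ^ 2 := by
    have hslice : Continuous fun x : V3 => (x, t) := by fun_prop
    rw [integral_add, integral_const_mul]
    · exact integrableOn_of_isBounded hΩb ((hu1.continuous.comp hslice).pow 2)
    · exact (integrableOn_of_isBounded hΩb ((hv1.continuous.comp hslice).pow 2)).const_mul _
  rw [integral_combination hΩb hT.le _ k hg, hsplit, hsplit, Fin.sum_univ_four] at hgrowth
  simp only [k, g, Matrix.cons_val] at hgrowth
  linarith
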